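/- arXiv:1402.0474 — 2 statements merged into one kernel-verified Lean document; each statement's English description precedes it below -/
import Mathlib

section
/- In the Lambek calculus with product L⊙, product eliminations can be permuted upwards: suppose a derivation of a sequent Γ[Δ] ⊢ C ends with a ⊙_e rule whose left premise Δ ⊢ A⊙B has derivation δ0 and whose right premise Γ[A,B] ⊢ C is the conclusion of a rule R' applied to a premise Θ[A,B] ⊢ X containing both discharged hypothesis occurrences A and B, with derivation δ1 (together with a second premise Ψ ⊢ U with derivation δ2 when R' is binary). Then there is a derivation of the same sequent Γ[Δ] ⊢ C whose last rule is R', obtained by first applying ⊙_e to δ0 and δ1, yielding Θ[Δ] ⊢ X, and then applying R' (to this new derivation and δ2 when R' is binary). -/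
/-!  Lambek calculus with product L⊙ : formulas, natural deduction derivations,
     rules, principal branches, extended redexes, normal derivations. -/

/-- Formulas of the Lambek calculus with product. -/
inductive Fm : Type
  | var  : ℕ → Fm
  | prod : Fm → Fm → Fm   -- A ⊙ B
  | ldiv : Fm → Fm → Fm   -- ldiv A C  =  A \ C
  | rdiv : Fm → Fm → Fm   -- rdiv C A  =  C / A
  deriving DecidableEq

/-- Natural deduction derivations of L⊙, indexed by the (nonempty) list of
hypotheses and the conclusion. -/
inductive Deriv : List Fm → Fm → Type
  | ax (A : Fm) : Deriv [A] A
  | ldivE {Γ Δ : List Fm} {A C : Fm} :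
      Deriv Γ A → Deriv Δ (Fm.ldiv A C) → Deriv (Γ ++ Δ) C
  | rdivE {Δ Γ : List Fm} {A C : Fm} :
      Deriv Δ (Fm.rdiv C A) → Deriv Γ A → Deriv (Δ ++ Γ) C
  | ldivI {Γ : List Fm} {A C : Fm} :
      Γ ≠ [] → Deriv (A :: Γ) C → Deriv Γ (Fm.ldiv A C)
  | rdivI {Γ : List Fm} {A C : Fm} :
      Γ ≠ [] → Deriv (Γ ++ [A]) C → Deriv Γ (Fm.rdiv C A)
  | prodI {Δ Γ : List Fm} {A B : Fm} :
      Deriv Δ A → Deriv Γ B → Deriv (Δ ++ Γ) (Fm.prod A B)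
  | prodE {Δ : List Fm} {A B : Fm} {Γ Γ' : List Fm} {C : Fm} :
      Deriv Δ (Fm.prod A B) → Deriv (Γ ++ A :: B :: Γ') C →
      Deriv (Γ ++ Δ ++ Γ') C

/-- Names of the rules of L⊙. -/
inductive Rule : Type
  | ax | ldivE | rdivE | ldivI | rdivI | prodI | prodE
  deriving DecidableEq

/-- A derivation together with its sequent. -/
abbrev DTree : Type := Σ (Γ : List Fm) (C : Fm), Deriv Γ C

/-- The last rule of a derivation. -/
def lastRule : ∀ {Γ C}, Deriv Γ C → Rule
  | _, _, .ax _ => .ax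
  | _, _, .ldivE _ _ => .ldivE
  | _, _, .rdivE _ _ => .rdivE
  | _, _, .ldivI _ _ => .ldivI
  | _, _, .rdivI _ _ => .rdivI
  | _, _, .prodI _ _ => .prodI
  | _, _, .prodE _ _ => .prodE

/-- The premises of the last rule of a derivation. -/
def premises : ∀ {Γ C}, Deriv Γ C → List DTree
  | _, _, .ax _ => []
  | _, _, .ldivE d₁ d₂ => [⟨_, _, d₁⟩, ⟨_, _, d₂⟩]
  | _, _, .rdivE d₁ d₂ => [⟨_, _, d₁⟩, ⟨_, _, d₂⟩]
  | _, _, .ldivI _ d => [⟨_, _, d⟩]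
  | _, _, .rdivI _ d => [⟨_, _, d⟩]
  | _, _, .prodI d₁ d₂ => [⟨_, _, d₁⟩, ⟨_, _, d₂⟩]
  | _, _, .prodE d₁ d₂ => [⟨_, _, d₁⟩, ⟨_, _, d₂⟩]

/-- The premise through which the principal branch continues: the premise of a
unary rule, the major (implication) premise of an implicative elimination, the
premise in which the hypotheses are discharged for `⊙ₑ`. -/
def principalPremise : ∀ {Γ C}, Deriv Γ C → Option DTree
  | _, _, .ax _ => none
  | _, _, .ldivE _ d₂ => some ⟨_, _, d₂⟩
  | _, _, .rdivE d₁ _ => some ⟨_, _, d₁⟩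
  | _, _, .ldivI _ d => some ⟨_, _, d⟩
  | _, _, .rdivI _ d => some ⟨_, _, d⟩
  | _, _, .prodI _ _ => none
  | _, _, .prodE _ d₂ => some ⟨_, _, d₂⟩

/-- Number of rules in a derivation. -/
def size : ∀ {Γ C}, Deriv Γ C → ℕ
  | _, _, .ax _ => 1
  | _, _, .ldivE d₁ d₂ => size d₁ + size d₂ + 1
  | _, _, .rdivE d₁ d₂ => size d₁ + size d₂ + 1
  | _, _, .ldivI _ d => size d + 1
  | _, _, .rdivI _ d => size d + 1
  | _, _, .prodI d₁ d₂ => size d₁ + size d₂ + 1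
  | _, _, .prodE d₁ d₂ => size d₁ + size d₂ + 1

/-- All subderivations (occurrences of sequents) of a derivation. -/
def subtrees : ∀ {Γ C}, Deriv Γ C → List DTree
  | _, _, .ax A => [⟨_, _, .ax A⟩]
  | _, _, .ldivE d₁ d₂ => ⟨_, _, .ldivE d₁ d₂⟩ :: (subtrees d₁ ++ subtrees d₂)
  | _, _, .rdivE d₁ d₂ => ⟨_, _, .rdivE d₁ d₂⟩ :: (subtrees d₁ ++ subtrees d₂)
  | _, _, .ldivI h d => ⟨_, _, .ldivI h d⟩ :: subtrees d
  | _, _, .rdivI h d => ⟨_, _, .rdivI h d⟩ :: subtrees d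
  | _, _, .prodI d₁ d₂ => ⟨_, _, .prodI d₁ d₂⟩ :: (subtrees d₁ ++ subtrees d₂)
  | _, _, .prodE d₁ d₂ => ⟨_, _, .prodE d₁ d₂⟩ :: (subtrees d₁ ++ subtrees d₂)

/-- `stepN k d` goes `k` steps up the principal branch starting at `d`. -/
def stepN : ℕ → DTree → Option DTree
  | 0, d => some d
  | k + 1, d => (principalPremise d.2.2).bind (stepN k)

def IsElim (r : Rule) : Prop := r = .ldivE ∨ r = .rdivE ∨ r = .prodE

def IsIntro (r : Rule) : Prop := r = .ldivI ∨ r = .rdivI ∨ r = .prodI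

/-- There is a path of length `k` along the principal branch from `d₀` to the
conclusion of an introduction rule with the same right-hand-side formula. -/
def ExtRedexFrom (k : ℕ) (d₀ : DTree) : Prop :=
  ∃ dk : DTree, stepN k d₀ = some dk ∧ IsIntro (lastRule dk.2.2) ∧ dk.2.1 = d₀.2.1

/-- The root of `d` is an elimination rule whose principal premise starts a
`k`-extended-redex. -/
def ExtRedexAt (k : ℕ) (d : DTree) : Prop :=
  IsElim (lastRule d.2.2) ∧
    ∃ d₀ : DTree, principalPremise d.2.2 = some d₀ ∧ ExtRedexFrom k d₀

/-- The derivation contains a `k`-extended-redex. -/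
def HasExtRedex {Γ C} (k : ℕ) (δ : Deriv Γ C) : Prop :=
  ∃ d ∈ subtrees δ, ExtRedexAt k d

/-- Adjacent positions `k`, `k+1` lie on the same side of a split `m | n`. -/
def sameSide (m n k : ℕ) : Prop := k + 2 ≤ m ∨ (m ≤ k ∧ k + 2 ≤ m + n)

/-- `SamePremise d n` : the hypothesis occurrences at positions `n` and `n+1`
of the context of `d` both come from the same premise of the last rule of `d`. -/
def SamePremise : ∀ {Γ C}, Deriv Γ C → ℕ → Prop
  | _, _, .ax _, _ => False
  | _, _, @Deriv.ldivE Γ Δ _ _ _ _, n => sameSide Γ.length Δ.length n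
  | _, _, @Deriv.rdivE Δ Γ _ _ _ _, n => sameSide Δ.length Γ.length n
  | _, _, .ldivI _ _, _ => True
  | _, _, .rdivI _ _, _ => True
  | _, _, @Deriv.prodI Δ Γ _ _ _ _, n => sameSide Δ.length Γ.length n
  | _, _, @Deriv.prodE Δ _ _ Γ Γ' _ _ _, n =>
      n + 2 ≤ Γ.length ∨
      (Γ.length ≤ n ∧ n + 2 ≤ Γ.length + Δ.length) ∨
      (Γ.length + Δ.length ≤ n ∧ n + 2 ≤ Γ.length + Δ.length + Γ'.length)

/-- A `⊙ₑ` rule at the root is as high as possible: the two discharged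
hypotheses do not come from the same premise of the rule above it. -/
def HighestAt : ∀ {Γ C}, Deriv Γ C → Prop
  | _, _, @Deriv.prodE _ _ _ Γ _ _ _ δr => ¬ SamePremise δr Γ.length
  | _, _, _ => True

/-- A derivation is normal: no `k`-extended-redex for any `k`, and every `⊙ₑ`
rule is as high as possible. -/
def NormalDeriv {Γ C} (δ : Deriv Γ C) : Prop :=
  (∀ k, ¬ HasExtRedex k δ) ∧ ∀ d ∈ subtrees δ, HighestAt d.2.2

/-- Subformula relation. -/
inductive Subf : Fm → Fm → Prop
  | refl (A : Fm) : Subf A A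
  | prodL {F A B} : Subf F A → Subf F (Fm.prod A B)
  | prodR {F A B} : Subf F B → Subf F (Fm.prod A B)
  | ldivL {F A B} : Subf F A → Subf F (Fm.ldiv A B)
  | ldivR {F A B} : Subf F B → Subf F (Fm.ldiv A B)
  | rdivL {F A B} : Subf F A → Subf F (Fm.rdiv A B)
  | rdivR {F A B} : Subf F B → Subf F (Fm.rdiv A B)

/-! Substitution of a derivation for a hypothesis occurrence, redex
contraction, upward permutation of product eliminations, and one-step
reduction. -/

/-- `IsSubst d n e d'` : `d'` is obtained from the derivation `d` by replacing
the hypothesis occurrence at position `n` of its context by the derivation `e`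
(of that hypothesis). -/
inductive IsSubst : DTree → ℕ → DTree → DTree → Prop
  | ax {Δ : List Fm} {A : Fm} (e : Deriv Δ A) :
      IsSubst ⟨[A], A, .ax A⟩ 0 ⟨Δ, A, e⟩ ⟨Δ, A, e⟩
  | ldivE_l {Γ₁ Γ₁' Γ₂ Δ : List Fm} {X A C : Fm} {n : ℕ}
      {d₁ : Deriv Γ₁ X} {d₂ : Deriv Γ₂ (Fm.ldiv X C)} {e : Deriv Δ A} {d₁' : Deriv Γ₁' X} :
      IsSubst ⟨Γ₁, X, d₁⟩ n ⟨Δ, A, e⟩ ⟨Γ₁', X, d₁'⟩ →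
      IsSubst ⟨Γ₁ ++ Γ₂, C, .ldivE d₁ d₂⟩ n ⟨Δ, A, e⟩ ⟨Γ₁' ++ Γ₂, C, .ldivE d₁' d₂⟩
  | ldivE_r {Γ₁ Γ₂ Γ₂' Δ : List Fm} {X A C : Fm} {n : ℕ}
      {d₁ : Deriv Γ₁ X} {d₂ : Deriv Γ₂ (Fm.ldiv X C)} {e : Deriv Δ A} {d₂' : Deriv Γ₂' (Fm.ldiv X C)} :
      IsSubst ⟨Γ₂, Fm.ldiv X C, d₂⟩ n ⟨Δ, A, e⟩ ⟨Γ₂', Fm.ldiv X C, d₂'⟩ →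
      IsSubst ⟨Γ₁ ++ Γ₂, C, .ldivE d₁ d₂⟩ (Γ₁.length + n) ⟨Δ, A, e⟩ ⟨Γ₁ ++ Γ₂', C, .ldivE d₁ d₂'⟩
  | rdivE_l {Γ₁ Γ₁' Γ₂ Δ : List Fm} {X A C : Fm} {n : ℕ}
      {d₁ : Deriv Γ₁ (Fm.rdiv C X)} {d₂ : Deriv Γ₂ X} {e : Deriv Δ A} {d₁' : Deriv Γ₁' (Fm.rdiv C X)} :
      IsSubst ⟨Γ₁, Fm.rdiv C X, d₁⟩ n ⟨Δ, A, e⟩ ⟨Γ₁', Fm.rdiv C X, d₁'⟩ →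
      IsSubst ⟨Γ₁ ++ Γ₂, C, .rdivE d₁ d₂⟩ n ⟨Δ, A, e⟩ ⟨Γ₁' ++ Γ₂, C, .rdivE d₁' d₂⟩
  | rdivE_r {Γ₁ Γ₂ Γ₂' Δ : List Fm} {X A C : Fm} {n : ℕ}
      {d₁ : Deriv Γ₁ (Fm.rdiv C X)} {d₂ : Deriv Γ₂ X} {e : Deriv Δ A} {d₂' : Deriv Γ₂' X} :
      IsSubst ⟨Γ₂, X, d₂⟩ n ⟨Δ, A, e⟩ ⟨Γ₂', X, d₂'⟩ →
      IsSubst ⟨Γ₁ ++ Γ₂, C, .rdivE d₁ d₂⟩ (Γ₁.length + n) ⟨Δ, A, e⟩ ⟨Γ₁ ++ Γ₂', C, .rdivE d₁ d₂'⟩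
  | ldivI {Γ Γ' Δ : List Fm} {A B C : Fm} {n : ℕ} (h : Γ ≠ []) (h' : Γ' ≠ [])
      {d : Deriv (A :: Γ) C} {d' : Deriv (A :: Γ') C} {e : Deriv Δ B} :
      IsSubst ⟨A :: Γ, C, d⟩ (n + 1) ⟨Δ, B, e⟩ ⟨A :: Γ', C, d'⟩ →
      IsSubst ⟨Γ, Fm.ldiv A C, .ldivI h d⟩ n ⟨Δ, B, e⟩ ⟨Γ', Fm.ldiv A C, .ldivI h' d'⟩
  | rdivI {Γ Γ' Δ : List Fm} {A B C : Fm} {n : ℕ} (h : Γ ≠ []) (h' : Γ' ≠ [])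
      {d : Deriv (Γ ++ [A]) C} {d' : Deriv (Γ' ++ [A]) C} {e : Deriv Δ B} :
      n < Γ.length →
      IsSubst ⟨Γ ++ [A], C, d⟩ n ⟨Δ, B, e⟩ ⟨Γ' ++ [A], C, d'⟩ →
      IsSubst ⟨Γ, Fm.rdiv C A, .rdivI h d⟩ n ⟨Δ, B, e⟩ ⟨Γ', Fm.rdiv C A, .rdivI h' d'⟩
  | prodI_l {Γ₁ Γ₁' Γ₂ Δ : List Fm} {X Y A : Fm} {n : ℕ}
      {d₁ : Deriv Γ₁ X} {d₂ : Deriv Γ₂ Y} {e : Deriv Δ A} {d₁' : Deriv Γ₁' X} :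
      IsSubst ⟨Γ₁, X, d₁⟩ n ⟨Δ, A, e⟩ ⟨Γ₁', X, d₁'⟩ →
      IsSubst ⟨Γ₁ ++ Γ₂, Fm.prod X Y, .prodI d₁ d₂⟩ n ⟨Δ, A, e⟩
        ⟨Γ₁' ++ Γ₂, Fm.prod X Y, .prodI d₁' d₂⟩
  | prodI_r {Γ₁ Γ₂ Γ₂' Δ : List Fm} {X Y A : Fm} {n : ℕ}
      {d₁ : Deriv Γ₁ X} {d₂ : Deriv Γ₂ Y} {e : Deriv Δ A} {d₂' : Deriv Γ₂' Y} :
      IsSubst ⟨Γ₂, Y, d₂⟩ n ⟨Δ, A, e⟩ ⟨Γ₂', Y, d₂'⟩ →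
      IsSubst ⟨Γ₁ ++ Γ₂, Fm.prod X Y, .prodI d₁ d₂⟩ (Γ₁.length + n) ⟨Δ, A, e⟩
        ⟨Γ₁ ++ Γ₂', Fm.prod X Y, .prodI d₁ d₂'⟩
  | prodE_mid {Δ₀ Δ₀' γl γr Δ : List Fm} {A B X C : Fm} {n : ℕ}
      {d₀ : Deriv Δ₀ (Fm.prod A B)} {dr : Deriv (γl ++ A :: B :: γr) C}
      {e : Deriv Δ X} {d₀' : Deriv Δ₀' (Fm.prod A B)} :
      IsSubst ⟨Δ₀, Fm.prod A B, d₀⟩ n ⟨Δ, X, e⟩ ⟨Δ₀', Fm.prod A B, d₀'⟩ →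
      IsSubst ⟨γl ++ Δ₀ ++ γr, C, .prodE d₀ dr⟩ (γl.length + n) ⟨Δ, X, e⟩
        ⟨γl ++ Δ₀' ++ γr, C, .prodE d₀' dr⟩
  | prodE_outer_l {Δ₀ γl γl' γr Δ : List Fm} {A B X C : Fm} {n : ℕ}
      {d₀ : Deriv Δ₀ (Fm.prod A B)} {dr : Deriv (γl ++ A :: B :: γr) C}
      {e : Deriv Δ X} {dr' : Deriv (γl' ++ A :: B :: γr) C} :
      n < γl.length →
      IsSubst ⟨γl ++ A :: B :: γr, C, dr⟩ n ⟨Δ, X, e⟩ ⟨γl' ++ A :: B :: γr, C, dr'⟩ →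
      IsSubst ⟨γl ++ Δ₀ ++ γr, C, .prodE d₀ dr⟩ n ⟨Δ, X, e⟩
        ⟨γl' ++ Δ₀ ++ γr, C, .prodE d₀ dr'⟩
  | prodE_outer_r {Δ₀ γl γr γr' Δ : List Fm} {A B X C : Fm} {n : ℕ}
      {d₀ : Deriv Δ₀ (Fm.prod A B)} {dr : Deriv (γl ++ A :: B :: γr) C}
      {e : Deriv Δ X} {dr' : Deriv (γl ++ A :: B :: γr') C} :
      IsSubst ⟨γl ++ A :: B :: γr, C, dr⟩ (γl.length + 2 + n) ⟨Δ, X, e⟩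
        ⟨γl ++ A :: B :: γr', C, dr'⟩ →
      IsSubst ⟨γl ++ Δ₀ ++ γr, C, .prodE d₀ dr⟩ (γl.length + Δ₀.length + n) ⟨Δ, X, e⟩
        ⟨γl ++ Δ₀ ++ γr', C, .prodE d₀ dr'⟩

/-- `PremReplace d p p' d'` : `d'` is obtained from `d` by replacing the
premise `p` of its last rule by the derivation `p'` (with the same
right-hand-side formula) and reapplying the same rule. -/
inductive PremReplace : DTree → DTree → DTree → DTree → Prop
  | ldivE_l {Γ₁ Γ₁' Γ₂ : List Fm} {A C : Fm}
      (d₁ : Deriv Γ₁ A) (d₂ : Deriv Γ₂ (Fm.ldiv A C)) (d₁' : Deriv Γ₁' A) :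
      PremReplace ⟨Γ₁ ++ Γ₂, C, .ldivE d₁ d₂⟩ ⟨Γ₁, A, d₁⟩ ⟨Γ₁', A, d₁'⟩
        ⟨Γ₁' ++ Γ₂, C, .ldivE d₁' d₂⟩
  | ldivE_r {Γ₁ Γ₂ Γ₂' : List Fm} {A C : Fm}
      (d₁ : Deriv Γ₁ A) (d₂ : Deriv Γ₂ (Fm.ldiv A C)) (d₂' : Deriv Γ₂' (Fm.ldiv A C)) :
      PremReplace ⟨Γ₁ ++ Γ₂, C, .ldivE d₁ d₂⟩ ⟨Γ₂, Fm.ldiv A C, d₂⟩ ⟨Γ₂', Fm.ldiv A C, d₂'⟩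
        ⟨Γ₁ ++ Γ₂', C, .ldivE d₁ d₂'⟩
  | rdivE_l {Γ₁ Γ₁' Γ₂ : List Fm} {A C : Fm}
      (d₁ : Deriv Γ₁ (Fm.rdiv C A)) (d₂ : Deriv Γ₂ A) (d₁' : Deriv Γ₁' (Fm.rdiv C A)) :
      PremReplace ⟨Γ₁ ++ Γ₂, C, .rdivE d₁ d₂⟩ ⟨Γ₁, Fm.rdiv C A, d₁⟩ ⟨Γ₁', Fm.rdiv C A, d₁'⟩
        ⟨Γ₁' ++ Γ₂, C, .rdivE d₁' d₂⟩
  | rdivE_r {Γ₁ Γ₂ Γ₂' : List Fm} {A C : Fm}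
      (d₁ : Deriv Γ₁ (Fm.rdiv C A)) (d₂ : Deriv Γ₂ A) (d₂' : Deriv Γ₂' A) :
      PremReplace ⟨Γ₁ ++ Γ₂, C, .rdivE d₁ d₂⟩ ⟨Γ₂, A, d₂⟩ ⟨Γ₂', A, d₂'⟩
        ⟨Γ₁ ++ Γ₂', C, .rdivE d₁ d₂'⟩
  | ldivI {Γ Γ' : List Fm} {A C : Fm} (h : Γ ≠ []) (h' : Γ' ≠ [])
      (d : Deriv (A :: Γ) C) (d' : Deriv (A :: Γ') C) :
      PremReplace ⟨Γ, Fm.ldiv A C, .ldivI h d⟩ ⟨A :: Γ, C, d⟩ ⟨A :: Γ', C, d'⟩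
        ⟨Γ', Fm.ldiv A C, .ldivI h' d'⟩
  | rdivI {Γ Γ' : List Fm} {A C : Fm} (h : Γ ≠ []) (h' : Γ' ≠ [])
      (d : Deriv (Γ ++ [A]) C) (d' : Deriv (Γ' ++ [A]) C) :
      PremReplace ⟨Γ, Fm.rdiv C A, .rdivI h d⟩ ⟨Γ ++ [A], C, d⟩ ⟨Γ' ++ [A], C, d'⟩
        ⟨Γ', Fm.rdiv C A, .rdivI h' d'⟩
  | prodI_l {Γ₁ Γ₁' Γ₂ : List Fm} {A B : Fm}
      (d₁ : Deriv Γ₁ A) (d₂ : Deriv Γ₂ B) (d₁' : Deriv Γ₁' A) :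
      PremReplace ⟨Γ₁ ++ Γ₂, Fm.prod A B, .prodI d₁ d₂⟩ ⟨Γ₁, A, d₁⟩ ⟨Γ₁', A, d₁'⟩
        ⟨Γ₁' ++ Γ₂, Fm.prod A B, .prodI d₁' d₂⟩
  | prodI_r {Γ₁ Γ₂ Γ₂' : List Fm} {A B : Fm}
      (d₁ : Deriv Γ₁ A) (d₂ : Deriv Γ₂ B) (d₂' : Deriv Γ₂' B) :
      PremReplace ⟨Γ₁ ++ Γ₂, Fm.prod A B, .prodI d₁ d₂⟩ ⟨Γ₂, B, d₂⟩ ⟨Γ₂', B, d₂'⟩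
        ⟨Γ₁ ++ Γ₂', Fm.prod A B, .prodI d₁ d₂'⟩
  | prodE_l {Δ₀ Δ₀' γl γr : List Fm} {A B C : Fm}
      (d₀ : Deriv Δ₀ (Fm.prod A B)) (dr : Deriv (γl ++ A :: B :: γr) C)
      (d₀' : Deriv Δ₀' (Fm.prod A B)) :
      PremReplace ⟨γl ++ Δ₀ ++ γr, C, .prodE d₀ dr⟩ ⟨Δ₀, Fm.prod A B, d₀⟩
        ⟨Δ₀', Fm.prod A B, d₀'⟩ ⟨γl ++ Δ₀' ++ γr, C, .prodE d₀' dr⟩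
  | prodE_r {Δ₀ γl γl' γr γr' : List Fm} {A B C : Fm}
      (d₀ : Deriv Δ₀ (Fm.prod A B)) (dr : Deriv (γl ++ A :: B :: γr) C)
      (dr' : Deriv (γl' ++ A :: B :: γr') C) :
      PremReplace ⟨γl ++ Δ₀ ++ γr, C, .prodE d₀ dr⟩ ⟨γl ++ A :: B :: γr, C, dr⟩
        ⟨γl' ++ A :: B :: γr', C, dr'⟩ ⟨γl' ++ Δ₀ ++ γr', C, .prodE d₀ dr'⟩

/-- Contraction of the four redexes of L⊙. -/
inductive Contract : DTree → DTree → Prop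
  | ldiv {Γ Δ : List Fm} {A C : Fm} (hne : Γ ≠ [])
      (δ₁ : Deriv Δ A) (δ : Deriv (A :: Γ) C) (d' : DTree)
      (h : IsSubst ⟨A :: Γ, C, δ⟩ 0 ⟨Δ, A, δ₁⟩ d') :
      Contract ⟨Δ ++ Γ, C, .ldivE δ₁ (.ldivI hne δ)⟩ d'
  | rdiv {Γ Δ : List Fm} {A C : Fm} (hne : Γ ≠ [])
      (δ₁ : Deriv Δ A) (δ : Deriv (Γ ++ [A]) C) (d' : DTree)
      (h : IsSubst ⟨Γ ++ [A], C, δ⟩ Γ.length ⟨Δ, A, δ₁⟩ d') :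
      Contract ⟨Γ ++ Δ, C, .rdivE (.rdivI hne δ) δ₁⟩ d'
  | prod_left {Δ₁ Δ₂ γl γr : List Fm} {A B C : Fm}
      (δ₁ : Deriv Δ₁ A) (δ₂ : Deriv Δ₂ B) (δr : Deriv (γl ++ A :: B :: γr) C)
      (dmid d' : DTree)
      (h₂ : IsSubst ⟨γl ++ A :: B :: γr, C, δr⟩ (γl.length + 1) ⟨Δ₂, B, δ₂⟩ dmid)
      (h₁ : IsSubst dmid γl.length ⟨Δ₁, A, δ₁⟩ d') :
      Contract ⟨γl ++ (Δ₁ ++ Δ₂) ++ γr, C, .prodE (.prodI δ₁ δ₂) δr⟩ d'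
  | prod_right {Δ : List Fm} {A B : Fm} (δ₀ : Deriv Δ (Fm.prod A B)) :
      Contract ⟨[] ++ Δ ++ [], Fm.prod A B,
          .prodE δ₀ (Deriv.prodI (Γ := [B]) (.ax A) (.ax B))⟩
        ⟨Δ, Fm.prod A B, δ₀⟩

/-- Upward permutation of a `⊙ₑ` rule above the rule producing its right
premise, when both discharged hypotheses lie in the same premise of that rule. -/
inductive Permute : DTree → DTree → Prop
  | mk {Δ γl γr θl θr : List Fm} {A B C X : Fm}
      (δ₀ : Deriv Δ (Fm.prod A B)) (δr : Deriv (γl ++ A :: B :: γr) C)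
      (δ₁ : Deriv (θl ++ A :: B :: θr) X) (d' : DTree)
      (hrep : PremReplace ⟨γl ++ A :: B :: γr, C, δr⟩ ⟨θl ++ A :: B :: θr, X, δ₁⟩
        ⟨θl ++ Δ ++ θr, X, .prodE δ₀ δ₁⟩ d') :
      Permute ⟨γl ++ Δ ++ γr, C, .prodE δ₀ δr⟩ d'

/-- One-step reduction: contraction of a redex or upward permutation of a
`⊙ₑ` rule, anywhere in the derivation. -/
inductive Step : DTree → DTree → Prop
  | contract {d d' : DTree} : Contract d d' → Step d d'
  | permute {d d' : DTree} : Permute d d' → Step d d'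
  | cong {d p p' d' : DTree} : PremReplace d p p' d' → Step p p' → Step d d'

theorem Deriv.ctx_ne_nil : ∀ {Γ C}, Deriv Γ C → Γ ≠ []
  | _, _, .ax _ => by simp
  | _, _, .ldivE d₁ _ => by simp [Deriv.ctx_ne_nil d₁]
  | _, _, .rdivE d₁ _ => by simp [Deriv.ctx_ne_nil d₁]
  | _, _, .ldivI h _ => h
  | _, _, .rdivI h _ => h
  | _, _, .prodI d₁ _ => by simp [Deriv.ctx_ne_nil d₁]
  | _, _, .prodE d₁ _ => by simp [Deriv.ctx_ne_nil d₁]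

theorem split_left {P Q γl γr : List Fm} {A B : Fm}
    (h : P ++ Q = γl ++ A :: B :: γr) (hl : γl.length + 2 ≤ P.length) :
    ∃ μ, P = γl ++ A :: B :: μ ∧ γr = μ ++ Q := by
  have h' : P ++ Q = (γl ++ [A, B]) ++ γr := by simpa using h
  rcases List.append_eq_append_iff.1 h' with ⟨a, h1, h2⟩ | ⟨a, h1, h2⟩
  · have := congrArg List.length h1
    simp at this
    have ha : a = [] := List.eq_nil_of_length_eq_zero (by omega)
    subst ha
    exact ⟨[], by simpa using h1.symm, by simpa using h2.symm⟩
  · exact ⟨a, by simpa using h1, h2⟩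

theorem split_right {P Q γl : List Fm} {R : List Fm}
    (h : P ++ Q = γl ++ R) (hl : P.length ≤ γl.length) :
    ∃ μ, γl = P ++ μ ∧ Q = μ ++ R := by
  rcases List.append_eq_append_iff.1 h with ⟨a, h1, h2⟩ | ⟨a, h1, h2⟩
  · exact ⟨a, h1, h2⟩
  · have := congrArg List.length h1
    simp at this
    have ha : a = [] := List.eq_nil_of_length_eq_zero (by omega)
    subst ha
    exact ⟨[], by simpa using h1.symm, by simpa using h2.symm⟩

theorem recast {Γ Γ' : List Fm} {C : Fm} (d : Deriv Γ C) (h : Γ = Γ') :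
    ∃ d' : Deriv Γ' C, (⟨Γ', C, d'⟩ : DTree) = ⟨Γ, C, d⟩ := by
  subst h
  exact ⟨d, rfl⟩

theorem rises_aux {Δ : List Fm} {A B : Fm} (δ0 : Deriv Δ (Fm.prod A B))
    {Λ : List Fm} {C : Fm} (δr : Deriv Λ C) (γl γr : List Fm)
    (hΛ : Λ = γl ++ A :: B :: γr) (hsame : SamePremise δr γl.length) :
    ∃ (Λ' : List Fm) (_ : Λ' = γl ++ Δ ++ γr) (δ' : Deriv Λ' C),
      lastRule δ' = lastRule δr ∧
      ∃ (θl θr : List Fm) (X : Fm) (δ1 : Deriv (θl ++ A :: B :: θr) X),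
        (⟨θl ++ A :: B :: θr, X, δ1⟩ : DTree) ∈ premises δr ∧
        (⟨θl ++ Δ ++ θr, X, Deriv.prodE δ0 δ1⟩ : DTree) ∈ premises δ' := by
  cases δr with
  | ax => exact hsame.elim
  | ldivE d₁ d₂ =>
    rcases hsame with h | ⟨h, -⟩
    · obtain ⟨μ, rfl, rfl⟩ := split_left hΛ h
      exact ⟨_, by simp, .ldivE (.prodE δ0 d₁) d₂, rfl, _, _, _, d₁,
        List.mem_cons_self, List.mem_cons_self⟩
    · obtain ⟨μ, rfl, rfl⟩ := split_right hΛ h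
      exact ⟨_, by simp, .ldivE d₁ (.prodE δ0 d₂), rfl, _, _, _, d₂,
        List.mem_cons_of_mem _ (List.mem_singleton.2 rfl),
        List.mem_cons_of_mem _ (List.mem_singleton.2 rfl)⟩
  | rdivE d₁ d₂ =>
    rcases hsame with h | ⟨h, -⟩
    · obtain ⟨μ, rfl, rfl⟩ := split_left hΛ h
      exact ⟨_, by simp, .rdivE (.prodE δ0 d₁) d₂, rfl, _, _, _, d₁,
        List.mem_cons_self, List.mem_cons_self⟩
    · obtain ⟨μ, rfl, rfl⟩ := split_right hΛ h
      exact ⟨_, by simp, .rdivE d₁ (.prodE δ0 d₂), rfl, _, _, _, d₂,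
        List.mem_cons_of_mem _ (List.mem_singleton.2 rfl),
        List.mem_cons_of_mem _ (List.mem_singleton.2 rfl)⟩
  | prodI d₁ d₂ =>
    rcases hsame with h | ⟨h, -⟩
    · obtain ⟨μ, rfl, rfl⟩ := split_left hΛ h
      exact ⟨_, by simp, .prodI (.prodE δ0 d₁) d₂, rfl, _, _, _, d₁,
        List.mem_cons_self, List.mem_cons_self⟩
    · obtain ⟨μ, rfl, rfl⟩ := split_right hΛ h
      exact ⟨_, by simp, .prodI d₁ (.prodE δ0 d₂), rfl, _, _, _, d₂,
        List.mem_cons_of_mem _ (List.mem_singleton.2 rfl),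
        List.mem_cons_of_mem _ (List.mem_singleton.2 rfl)⟩
  | ldivI hne d =>
    subst hΛ
    exact ⟨_, rfl, .ldivI (by simp [δ0.ctx_ne_nil])
      (Deriv.prodE (Γ := _ :: γl) (Γ' := γr) δ0 d), rfl,
      _ :: γl, γr, _, d, by simp [premises], by simp [premises]⟩
  | @rdivI _ A' _ hne d =>
    subst hΛ
    obtain ⟨d1, h1⟩ := recast (Γ' := γl ++ A :: B :: (γr ++ [A'])) d (by simp)
    obtain ⟨d2, h2⟩ := recast (Γ' := (γl ++ Δ ++ γr) ++ [A']) (Deriv.prodE δ0 d1) (by simp)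
    exact ⟨_, rfl, .rdivI (by simp [δ0.ctx_ne_nil]) d2, rfl,
      γl, γr ++ [A'], _, d1, by rw [h1]; exact List.mem_singleton.2 rfl,
      by rw [← h2]; exact List.mem_singleton.2 rfl⟩
  | @prodE Δ0 A' B' Γ Γ' _ d₁ d₂ =>
    rcases hsame with h | ⟨ha, hb⟩ | ⟨ha, -⟩
    · obtain ⟨μ, h1, rfl⟩ := split_left (P := Γ) (Q := Δ0 ++ Γ') (by simpa using hΛ) h
      subst h1
      obtain ⟨d, h1⟩ := recast (Γ' := γl ++ A :: B :: (μ ++ A' :: B' :: Γ')) d₂ (by simp)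
      obtain ⟨d', h2⟩ := recast (Γ' := (γl ++ Δ ++ μ) ++ A' :: B' :: Γ')
        (Deriv.prodE δ0 d) (by simp)
      exact ⟨_, by simp, .prodE d₁ d', rfl, _, _, _, d,
        by rw [h1]; exact List.mem_cons_of_mem _ (List.mem_singleton.2 rfl),
        by rw [← h2]; exact List.mem_cons_of_mem _ (List.mem_singleton.2 rfl)⟩
    · obtain ⟨μ, h1, rfl⟩ := split_left hΛ (by simpa using hb)
      obtain ⟨ν, rfl, rfl⟩ := split_right h1 ha
      exact ⟨_, by simp, .prodE (.prodE δ0 d₁) d₂, rfl, _, _, _, d₁,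
        List.mem_cons_self, List.mem_cons_self⟩
    · obtain ⟨μ, rfl, rfl⟩ := split_right hΛ (by simpa using ha)
      obtain ⟨d, h1⟩ := recast (Γ' := (Γ ++ A' :: B' :: μ) ++ A :: B :: γr) d₂ (by simp)
      obtain ⟨d', h2⟩ := recast (Γ' := Γ ++ A' :: B' :: (μ ++ Δ ++ γr))
        (Deriv.prodE δ0 d) (by simp)
      exact ⟨_, by simp, .prodE d₁ d', rfl, _, _, _, d,
        by rw [h1]; exact List.mem_cons_of_mem _ (List.mem_singleton.2 rfl),
        by rw [← h2]; exact List.mem_cons_of_mem _ (List.mem_singleton.2 rfl)⟩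

/-- In L⊙, product eliminations can be permuted upwards.
If a derivation of `Γ[Δ] ⊢ C` ends with `⊙ₑ` applied to `δ0 : Δ ⊢ A⊙B` and to a
right premise `δr : Γ[A,B] ⊢ C` which is the conclusion of a rule `R'` whose
premise containing both discharged hypotheses is `Θ[A,B] ⊢ X` (derivation
`δ1`), then there is a derivation of `Γ[Δ] ⊢ C` whose last rule is `R'`,
obtained by first applying `⊙ₑ` to `δ0` and `δ1` (yielding `Θ[Δ] ⊢ X`) and
then applying `R'`. -/
theorem product_elim_rises_Lprod
    {Δ γl γr : List Fm} {A B C : Fm}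
    (δ0 : Deriv Δ (Fm.prod A B)) (δr : Deriv (γl ++ A :: B :: γr) C)
    (hax : lastRule δr ≠ Rule.ax)
    (hsame : SamePremise δr γl.length) :
    ∃ δ' : Deriv (γl ++ Δ ++ γr) C,
      lastRule δ' = lastRule δr ∧
      ∃ (θl θr : List Fm) (X : Fm) (δ1 : Deriv (θl ++ A :: B :: θr) X),
        (⟨θl ++ A :: B :: θr, X, δ1⟩ : DTree) ∈ premises δr ∧
        (⟨θl ++ Δ ++ θr, X, Deriv.prodE δ0 δ1⟩ : DTree) ∈ premises δ' := by
  obtain ⟨Λ', rfl, δ', h⟩ := rises_aux δ0 δr γl γr rfl hsame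
  exact ⟨δ', h⟩
end

section
/- Subject reduction for redex contraction in L⊙: contracting any of the four redexes of L⊙ yields a derivation of the same sequent with strictly fewer rules. Precisely: (i) if a \_e rule has right premise Γ ⊢ D\C obtained by \_i from a derivation δ of D,Γ ⊢ C, and left premise Δ ⊢ D with derivation δ1, then substituting δ1 for the hypothesis D in δ yields a derivation of Δ,Γ ⊢ C; (ii) symmetrically for a /_e rule whose major premise is obtained by /_i; (iii) if a ⊙_e rule has left premise Δ1,Δ2 ⊢ A⊙B obtained by ⊙_i from derivations of Δ1 ⊢ A and Δ2 ⊢ B, then substituting these derivations for the discharged hypotheses A and B in the derivation of the right premise yields a derivation of the conclusion; (iv) if a ⊙_e rule has right premise A,B ⊢ A⊙B obtained by ⊙_i from two axioms, then the derivation of the left premise is already a derivation of the conclusion. In each case the number of rules strictly decreases. -/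
theorem deriv_ne_nil {Γ : List Fm} {C : Fm} (d : Deriv Γ C) : Γ ≠ [] := by
  induction d <;> simp_all

theorem split_app {Γ₁ Γ₂ l r : List Fm} {A : Fm} (h : Γ₁ ++ Γ₂ = l ++ A :: r) :
    (∃ m, Γ₁ = l ++ A :: m ∧ r = m ++ Γ₂) ∨ (∃ m, l = Γ₁ ++ m ∧ Γ₂ = m ++ A :: r) := by
  rcases List.append_eq_append_iff.1 h with ⟨a, h1, h2⟩ | ⟨c, h1, h2⟩
  · exact Or.inr ⟨a, h1, h2⟩
  · cases c with
    | nil => exact Or.inr ⟨[], by simpa using h1.symm, by simpa using h2.symm⟩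
    | cons x m =>
      simp only [List.cons_append, List.cons.injEq] at h2
      obtain ⟨rfl, h2⟩ := h2
      exact Or.inl ⟨m, h1, h2⟩

theorem subst_exists {Γ : List Fm} {C : Fm} (d : Deriv Γ C) :
    ∀ (l r Δ : List Fm) (A : Fm) (e : Deriv Δ A) (n : ℕ) (G : List Fm),
      Γ = l ++ A :: r → n = l.length → G = l ++ Δ ++ r →
      ∃ d' : Deriv G C, IsSubst ⟨Γ, C, d⟩ n ⟨Δ, A, e⟩ ⟨G, C, d'⟩ ∧
        size d' + 1 = size d + size e := by
  induction d with
  | ax B =>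
    intro l r Δ A e n G h hn hG
    cases l with
    | cons x l => simp at h
    | nil =>
      simp only [List.nil_append, List.cons.injEq] at h
      obtain ⟨rfl, h⟩ := h
      subst h hn
      simp only [List.nil_append, List.append_nil] at hG
      subst hG
      exact ⟨e, .ax e, by simp [size, Nat.add_comm]⟩
  | @ldivE Γ₁ Γ₂ _ _ d₁ d₂ ih₁ ih₂ =>
    intro l r Δ A e n G h hn hG
    rcases split_app h with ⟨m, h1, h2⟩ | ⟨m, h1, h2⟩
    · obtain ⟨d', hs, hz⟩ := ih₁ l m Δ A e n _ h1 hn rfl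
      obtain rfl : G = (l ++ Δ ++ m) ++ _ := by rw [hG, h2, ← List.append_assoc]
      exact ⟨.ldivE d' d₂, .ldivE_l hs, by simp only [size]; omega⟩
    · obtain ⟨d', hs, hz⟩ := ih₂ m r Δ A e _ _ h2 rfl rfl
      subst h1
      obtain rfl : G = Γ₁ ++ (m ++ Δ ++ r) := by rw [hG]; simp only [List.append_assoc]
      rw [List.length_append] at hn
      subst hn
      exact ⟨.ldivE d₁ d', .ldivE_r hs, by simp only [size]; omega⟩
  | @rdivE Γ₁ Γ₂ _ _ d₁ d₂ ih₁ ih₂ =>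
    intro l r Δ A e n G h hn hG
    rcases split_app h with ⟨m, h1, h2⟩ | ⟨m, h1, h2⟩
    · obtain ⟨d', hs, hz⟩ := ih₁ l m Δ A e n _ h1 hn rfl
      obtain rfl : G = (l ++ Δ ++ m) ++ _ := by rw [hG, h2, ← List.append_assoc]
      exact ⟨.rdivE d' d₂, .rdivE_l hs, by simp only [size]; omega⟩
    · obtain ⟨d', hs, hz⟩ := ih₂ m r Δ A e _ _ h2 rfl rfl
      subst h1
      obtain rfl : G = Γ₁ ++ (m ++ Δ ++ r) := by rw [hG]; simp only [List.append_assoc]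
      rw [List.length_append] at hn
      subst hn
      exact ⟨.rdivE d₁ d', .rdivE_r hs, by simp only [size]; omega⟩
  | @prodI Γ₁ Γ₂ _ _ d₁ d₂ ih₁ ih₂ =>
    intro l r Δ A e n G h hn hG
    rcases split_app h with ⟨m, h1, h2⟩ | ⟨m, h1, h2⟩
    · obtain ⟨d', hs, hz⟩ := ih₁ l m Δ A e n _ h1 hn rfl
      obtain rfl : G = (l ++ Δ ++ m) ++ _ := by rw [hG, h2, ← List.append_assoc]
      exact ⟨.prodI d' d₂, .prodI_l hs, by simp only [size]; omega⟩
    · obtain ⟨d', hs, hz⟩ := ih₂ m r Δ A e _ _ h2 rfl rfl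
      subst h1
      obtain rfl : G = Γ₁ ++ (m ++ Δ ++ r) := by rw [hG]; simp only [List.append_assoc]
      rw [List.length_append] at hn
      subst hn
      exact ⟨.prodI d₁ d', .prodI_r hs, by simp only [size]; omega⟩
  | ldivI hne d ih =>
    intro l r Δ A e n G h hn hG
    obtain ⟨d', hs, hz⟩ := ih (_ :: l) r Δ A e (n + 1) (_ :: G) (by rw [h]; rfl) (by simp [hn])
      (by rw [hG]; rfl)
    have hG' : G ≠ [] := by
      have := deriv_ne_nil e
      rw [hG]; simp [this]
    exact ⟨.ldivI hG' d', .ldivI hne hG' hs, by simp only [size]; omega⟩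
  | @rdivI Γ B C hne d ih =>
    intro l r Δ A e n G h hn hG
    obtain ⟨d', hs, hz⟩ := ih l (r ++ [B]) Δ A e n (G ++ [B]) (by rw [h]; simp) hn
      (by rw [hG]; simp)
    have hG' : G ≠ [] := by
      have := deriv_ne_nil e
      rw [hG]; simp [this]
    exact ⟨.rdivI hG' d', .rdivI hne hG' (by rw [hn, h]; simp) hs, by simp only [size]; omega⟩
  | @prodE Δ₀ X Y γl γr C d₀ dr ih₀ ihr =>
    intro l r Δ A e n G h hn hG
    rcases split_app h with ⟨m, h1, h2⟩ | ⟨m, h1, h2⟩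
    · rcases split_app h1 with ⟨k, h3, h4⟩ | ⟨k, h3, h4⟩
      · obtain ⟨d', hs, hz⟩ := ihr l (k ++ X :: Y :: γr) Δ A e n ((l ++ Δ ++ k) ++ X :: Y :: γr)
          (by rw [h3]; simp) hn (by simp)
        obtain rfl : G = (l ++ Δ ++ k) ++ Δ₀ ++ γr := by rw [hG, h2, h4]; simp
        exact ⟨.prodE d₀ d', .prodE_outer_l (by rw [hn, h3]; simp) hs, by simp only [size]; omega⟩
      · obtain ⟨d', hs, hz⟩ := ih₀ k m Δ A e _ _ h4 rfl rfl
        obtain rfl : G = γl ++ (k ++ Δ ++ m) ++ γr := by rw [hG, h2, h3]; simp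
        obtain rfl : n = γl.length + k.length := by rw [hn, h3]; simp
        exact ⟨.prodE d' dr, .prodE_mid hs, by simp only [size]; omega⟩
    · obtain ⟨d', hs, hz⟩ := ihr (γl ++ X :: Y :: m) r Δ A e (γl.length + 2 + m.length)
          (γl ++ X :: Y :: (m ++ Δ ++ r))
          (by rw [h2]; simp) (by simp; omega) (by simp)
      obtain rfl : G = γl ++ Δ₀ ++ (m ++ Δ ++ r) := by rw [hG, h1]; simp
      obtain rfl : n = γl.length + Δ₀.length + m.length := by rw [hn, h1]; simp; omega
      exact ⟨.prodE d₀ d', .prodE_outer_r hs, by simp only [size]; omega⟩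

/-- Subject reduction for redex contraction in L⊙: contracting
any of the four redexes yields a derivation of the same sequent with strictly
fewer rules.
(i) a `\ₑ` rule whose major premise is obtained by `\ᵢ`;
(ii) a `/ₑ` rule whose major premise is obtained by `/ᵢ`;
(iii) a `⊙ₑ` rule whose left premise is obtained by `⊙ᵢ`;
(iv) a `⊙ₑ` rule whose right premise `A,B ⊢ A⊙B` is obtained by `⊙ᵢ` from two
axioms.  -/
theorem subject_reduction_Lprod :
    (∀ (Γ Δ : List Fm) (A C : Fm) (hne : Γ ≠ [])
       (δ₁ : Deriv Δ A) (δ : Deriv (A :: Γ) C),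
       ∃ d' : DTree, IsSubst ⟨A :: Γ, C, δ⟩ 0 ⟨Δ, A, δ₁⟩ d' ∧
         d'.1 = Δ ++ Γ ∧ d'.2.1 = C ∧
         size d'.2.2 < size (Deriv.ldivE δ₁ (Deriv.ldivI hne δ))) ∧
    (∀ (Γ Δ : List Fm) (A C : Fm) (hne : Γ ≠ [])
       (δ₁ : Deriv Δ A) (δ : Deriv (Γ ++ [A]) C),
       ∃ d' : DTree, IsSubst ⟨Γ ++ [A], C, δ⟩ Γ.length ⟨Δ, A, δ₁⟩ d' ∧
         d'.1 = Γ ++ Δ ∧ d'.2.1 = C ∧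
         size d'.2.2 < size (Deriv.rdivE (Deriv.rdivI hne δ) δ₁)) ∧
    (∀ (Δ₁ Δ₂ γl γr : List Fm) (A B C : Fm)
       (δ₁ : Deriv Δ₁ A) (δ₂ : Deriv Δ₂ B) (δr : Deriv (γl ++ A :: B :: γr) C),
       ∃ dmid d' : DTree,
         IsSubst ⟨γl ++ A :: B :: γr, C, δr⟩ (γl.length + 1) ⟨Δ₂, B, δ₂⟩ dmid ∧
         IsSubst dmid γl.length ⟨Δ₁, A, δ₁⟩ d' ∧
         d'.1 = γl ++ (Δ₁ ++ Δ₂) ++ γr ∧ d'.2.1 = C ∧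
         size d'.2.2 < size (Deriv.prodE (Deriv.prodI δ₁ δ₂) δr)) ∧
    (∀ (Δ : List Fm) (A B : Fm) (δ₀ : Deriv Δ (Fm.prod A B)),
       ([] ++ Δ ++ [] : List Fm) = Δ ∧
       size δ₀ <
         size (Deriv.prodE (Γ := ([] : List Fm)) (Γ' := ([] : List Fm)) δ₀
           (Deriv.prodI (Γ := [B]) (.ax A) (.ax B)))) := by
  refine ⟨?_, ?_, ?_, ?_⟩
  · intro Γ Δ A C hne δ₁ δ
    obtain ⟨d', hs, hz⟩ := subst_exists δ [] Γ Δ A δ₁ 0 (Δ ++ Γ) rfl rfl rfl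
    exact ⟨_, hs, rfl, rfl, by simp only [size]; omega⟩
  · intro Γ Δ A C hne δ₁ δ
    obtain ⟨d', hs, hz⟩ := subst_exists δ Γ [] Δ A δ₁ _ (Γ ++ Δ) rfl rfl (by simp)
    exact ⟨_, hs, rfl, rfl, by simp only [size]; omega⟩
  · intro Δ₁ Δ₂ γl γr A B C δ₁ δ₂ δr
    obtain ⟨dm, hs, hz⟩ := subst_exists δr (γl ++ [A]) γr Δ₂ B δ₂ (γl.length + 1)
      (γl ++ A :: (Δ₂ ++ γr)) (by simp) (by simp) (by simp)
    obtain ⟨d', hs', hz'⟩ := subst_exists dm γl (Δ₂ ++ γr) Δ₁ A δ₁ γl.length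
      (γl ++ (Δ₁ ++ Δ₂) ++ γr) rfl rfl (by simp)
    exact ⟨_, _, hs, hs', rfl, rfl, by simp only [size]; omega⟩
  · intro Δ A B δ₀
    exact ⟨by simp, by simp only [size]; omega⟩
end
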